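/- arXiv:2604.09103 — 4 statements merged into one kernel-verified Lean document; each statement's English description precedes it below -/
import Mathlib

section
/- Suppose σ̄²·Δt/h² ≤ 1. Then for all real numbers a, b, c, letting δ := (a − 2b + c)/h², the supremum over s ∈ [σ̲², σ̄²] of the quantity (s·Δt/(2h²))·a + (1 − s·Δt/h²)·b + (s·Δt/(2h²))·c is attained and equals b + (Δt/2)·F(δ). In particular the one-step trinomial dynamic-programming update coincides with the explicit finite-difference update with the bang-bang coefficient. -/
/-- Bang-bang volatility: `σ²(z) = σ̄²` if `z ≥ 0`, else `σ̲²`. -/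
noncomputable def sig2 (σlo σhi z : ℝ) : ℝ := if 0 ≤ z then σhi ^ 2 else σlo ^ 2

/-- Nonlinear flux `F(v) = σ²(v) · v`. -/
noncomputable def Fflux (σlo σhi v : ℝ) : ℝ := sig2 σlo σhi v * v

/-- The trinomial update equals the explicit finite-difference update with coefficient `s`. -/
theorem trinomial_update_eq {h : ℝ} (hh : h ≠ 0) (Δt a b c s : ℝ) :
    s * Δt / (2 * h ^ 2) * a + (1 - s * Δt / h ^ 2) * b + s * Δt / (2 * h ^ 2) * c
      = b + Δt / 2 * (s * ((a - 2 * b + c) / h ^ 2)) := by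
  field_simp
  ring

theorem sig2_mem_Icc {σlo σhi : ℝ} (hσlo : 0 ≤ σlo) (hσ : σlo ≤ σhi) (z : ℝ) :
    sig2 σlo σhi z ∈ Set.Icc (σlo ^ 2) (σhi ^ 2) := by
  have hsq : σlo ^ 2 ≤ σhi ^ 2 := by gcongr
  unfold sig2
  split_ifs
  · exact ⟨hsq, le_rfl⟩
  · exact ⟨le_rfl, hsq⟩

theorem mul_le_Fflux {σlo σhi s : ℝ} (hs : s ∈ Set.Icc (σlo ^ 2) (σhi ^ 2)) (v : ℝ) :
    s * v ≤ Fflux σlo σhi v := by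
  unfold Fflux sig2
  split_ifs with hv
  · exact mul_le_mul_of_nonneg_right hs.2 hv
  · exact mul_le_mul_of_nonpos_right hs.1 (not_le.mp hv).le

/-- Under the CFL condition `σ̄²·Δt/h² ≤ 1`, for all reals `a, b, c`, with
`δ := (a − 2b + c)/h²`, the supremum over `s ∈ [σ̲², σ̄²]` of
`(s·Δt/(2h²))·a + (1 − s·Δt/h²)·b + (s·Δt/(2h²))·c` is attained and equals
`b + (Δt/2)·F(δ)`. -/
theorem stmt2 (σlo σhi h Δt : ℝ) (hσlo : 0 < σlo) (hσ : σlo ≤ σhi)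
    (hh : 0 < h) (hdt : 0 < Δt) (hcfl : σhi ^ 2 * Δt / h ^ 2 ≤ 1) :
    ∀ a b c : ℝ,
      IsGreatest
        ((fun s => s * Δt / (2 * h ^ 2) * a + (1 - s * Δt / h ^ 2) * b
            + s * Δt / (2 * h ^ 2) * c) '' Set.Icc (σlo ^ 2) (σhi ^ 2))
        (b + Δt / 2 * Fflux σlo σhi ((a - 2 * b + c) / h ^ 2)) ∧
      sSup ((fun s => s * Δt / (2 * h ^ 2) * a + (1 - s * Δt / h ^ 2) * b
            + s * Δt / (2 * h ^ 2) * c) '' Set.Icc (σlo ^ 2) (σhi ^ 2))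
        = b + Δt / 2 * Fflux σlo σhi ((a - 2 * b + c) / h ^ 2) := by
  intro a b c
  simp only [trinomial_update_eq hh.ne']
  refine (fun H => ⟨H, H.csSup_eq⟩) ⟨⟨_, sig2_mem_Icc hσlo.le hσ _, rfl⟩, ?_⟩
  rintro _ ⟨s, hs, rfl⟩
  have hle := mul_le_Fflux hs ((a - 2 * b + c) / h ^ 2)
  dsimp only
  gcongr
end

section
/- (Monotonicity of the backward scheme.) Suppose σ̄²·Δt/h² ≤ 1. Define the one-step operator S on maps U : ℤ → ℝ by S(U)_i := U_i + (Δt/2)·F((δ_h²U)_i). If Ũ, U : ℤ → ℝ satisfy Ũ_i ≥ U_i for every i ∈ ℤ, then S(Ũ)_i ≥ S(U)_i for every i ∈ ℤ. -/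
/-- Centered second difference `(δ_h²U)_i = (U_{i+1} − 2U_i + U_{i−1})/h²`. -/
noncomputable def secondDiff (h : ℝ) (U : ℤ → ℝ) (i : ℤ) : ℝ :=
  (U (i + 1) - 2 * U i + U (i - 1)) / h ^ 2

/-- One-step backward operator `S(U)_i = U_i + (Δt/2)·F((δ_h²U)_i)`. -/
noncomputable def Sstep (σlo σhi h Δt : ℝ) (U : ℤ → ℝ) (i : ℤ) : ℝ :=
  U i + Δt / 2 * Fflux σlo σhi (secondDiff h U i)

/-- The flux is nondecreasing with slope at most `σ̄²`. -/
theorem Fflux_le_add {σlo σhi v w c : ℝ} (hσlo : 0 ≤ σlo) (hσ : σlo ≤ σhi) (hc : 0 ≤ c)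
    (hw : w ≤ v + c) : Fflux σlo σhi w ≤ Fflux σlo σhi v + σhi ^ 2 * c := by
  have hsq : σlo ^ 2 ≤ σhi ^ 2 := pow_le_pow_left₀ hσlo hσ 2
  have hlo := sq_nonneg σlo
  have hhi := sq_nonneg σhi
  unfold Fflux sig2
  split_ifs with h₁ h₂ h₂
  · nlinarith
  · push Not at h₂
    nlinarith
  · push Not at h₁
    nlinarith [mul_nonneg hhi h₂, mul_nonneg hhi hc]
  · nlinarith [mul_nonneg (sub_nonneg.2 hsq) hc]

/-- Raising all nodal values lowers the second difference at `i` by at most `2 / h ^ 2` times the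
increase at `i`. -/
theorem secondDiff_le_add {h : ℝ} {U V : ℤ → ℝ} (hle : ∀ i, U i ≤ V i) (i : ℤ) :
    secondDiff h U i ≤ secondDiff h V i + 2 * (V i - U i) / h ^ 2 := by
  unfold secondDiff
  rw [← add_div]
  refine div_le_div_of_nonneg_right ?_ (sq_nonneg h)
  linarith [hle (i + 1), hle (i - 1)]

/-- Monotonicity of the backward scheme: under `σ̄²·Δt/h² ≤ 1`, if `Ũ ≥ U` pointwise
then `S(Ũ) ≥ S(U)` pointwise. -/
theorem stmt4 (σlo σhi h Δt : ℝ) (hσlo : 0 < σlo) (hσ : σlo ≤ σhi)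
    (hh : 0 < h) (hdt : 0 < Δt) (hcfl : σhi ^ 2 * Δt / h ^ 2 ≤ 1)
    (Ut U : ℤ → ℝ) (hle : ∀ i : ℤ, U i ≤ Ut i) :
    ∀ i : ℤ, Sstep σlo σhi h Δt U i ≤ Sstep σlo σhi h Δt Ut i := by
  intro i
  have hd : 0 ≤ Ut i - U i := sub_nonneg.2 (hle i)
  have hF := Fflux_le_add hσlo.le hσ (by positivity) (secondDiff_le_add (h := h) hle i)
  have hstep := mul_le_mul_of_nonneg_left hF (half_pos hdt).le
  have hcfl' := mul_le_mul_of_nonneg_right hcfl hd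
  have hrw : Δt / 2 * (σhi ^ 2 * (2 * (Ut i - U i) / h ^ 2)) =
      σhi ^ 2 * Δt / h ^ 2 * (Ut i - U i) := by ring
  unfold Sstep
  rw [mul_add, hrw] at hstep
  linarith
end

section
/- (Monotonicity of the w-scheme.) Suppose σ̄²·Δt/h² ≤ 1/2. If W̃, W : ℤ → ℝ satisfy W̃_i ≤ W_i for every i ∈ ℤ, then T(W̃)_i ≤ T(W)_i for every i ∈ ℤ. -/
/-- `B_i(W) = W_i + (Δt·σ²(W_i)/2)·(W_{i+1} − 2W_i + W_{i−1})/h²`. -/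
noncomputable def Bmap (σlo σhi h Δt : ℝ) (W : ℤ → ℝ) (i : ℤ) : ℝ :=
  W i + Δt * sig2 σlo σhi (W i) / 2 * ((W (i + 1) - 2 * W i + W (i - 1)) / h ^ 2)

/-- One-step map of the `w`-scheme: `T(W)_i = F(B_i(W))/σ²(W_i)`. -/
noncomputable def Tmap (σlo σhi h Δt : ℝ) (W : ℤ → ℝ) (i : ℤ) : ℝ :=
  Fflux σlo σhi (Bmap σlo σhi h Δt W i) / sig2 σlo σhi (W i)

theorem sig2_pos {σlo σhi : ℝ} (hσlo : 0 < σlo) (hσ : σlo ≤ σhi) (z : ℝ) :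
    0 < sig2 σlo σhi z := by
  have : 0 < σhi := hσlo.trans_le hσ
  unfold sig2
  split_ifs <;> positivity

theorem Fflux_monotone (σlo σhi : ℝ) : Monotone (Fflux σlo σhi) := by
  intro x y hxy
  unfold Fflux sig2
  split_ifs with hx hy hy
  · gcongr
  · linarith
  · exact (mul_nonpos_of_nonneg_of_nonpos (sq_nonneg _) (not_le.mp hx).le).trans
      (mul_nonneg (sq_nonneg _) hy)
  · gcongr

/-- The flux is positively homogeneous. -/
theorem Fflux_div (σlo σhi v : ℝ) {k : ℝ} (hk : 0 < k) :
    Fflux σlo σhi v / k = Fflux σlo σhi (v / k) := by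
  have h : 0 ≤ v / k ↔ 0 ≤ v := by rw [le_div_iff₀ hk, zero_mul]
  simp only [Fflux, sig2, h, mul_div_assoc]

/-- The map `w ↦ w / σ²(w)` has slope at least `1 / σ̄²`. -/
theorem sub_div_le_div_sig2_sub {σlo σhi : ℝ} (hσlo : 0 < σlo) (hσ : σlo ≤ σhi) {x y : ℝ}
    (hxy : x ≤ y) :
    (y - x) / σhi ^ 2 ≤ y / sig2 σlo σhi y - x / sig2 σlo σhi x := by
  have hinv : (σhi ^ 2)⁻¹ ≤ (σlo ^ 2)⁻¹ := by gcongr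
  unfold sig2
  simp only [div_eq_mul_inv]
  split_ifs with hy hx hx
  · linarith
  · nlinarith
  · linarith
  · nlinarith

theorem Tmap_eq {σlo σhi : ℝ} (h Δt : ℝ) (hσlo : 0 < σlo) (hσ : σlo ≤ σhi) (W : ℤ → ℝ)
    (i : ℤ) :
    Tmap σlo σhi h Δt W i = Fflux σlo σhi
      (W i / sig2 σlo σhi (W i) + Δt / h ^ 2 / 2 * (W (i + 1) - 2 * W i + W (i - 1))) := by
  have hs := sig2_pos hσlo hσ (W i)
  rw [Tmap, Fflux_div _ _ _ hs, Bmap]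
  congr 1
  rw [add_div]
  congr 1
  rw [div_eq_iff hs.ne']
  ring

/-- Monotonicity of the `w`-scheme: if `σ̄²·Δt/h² ≤ 1/2` and `W̃ ≤ W` pointwise,
then `T(W̃) ≤ T(W)` pointwise. -/
theorem stmt14 (σlo σhi h Δt : ℝ) (hσlo : 0 < σlo) (hσ : σlo ≤ σhi)
    (hh : 0 < h) (hdt : 0 < Δt) (hcfl : σhi ^ 2 * Δt / h ^ 2 ≤ 1 / 2)
    (Wt W : ℤ → ℝ) (hle : ∀ i : ℤ, Wt i ≤ W i) :
    ∀ i : ℤ, Tmap σlo σhi h Δt Wt i ≤ Tmap σlo σhi h Δt W i := by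
  intro i
  rw [Tmap_eq h Δt hσlo hσ, Tmap_eq h Δt hσlo hσ]
  apply Fflux_monotone
  have hhi : 0 < σhi ^ 2 := pow_pos (hσlo.trans_le hσ) 2
  have hr : 0 ≤ Δt / h ^ 2 := by positivity
  have hr' : Δt / h ^ 2 ≤ 1 / σhi ^ 2 := by
    rw [le_div_iff₀ hhi]
    calc Δt / h ^ 2 * σhi ^ 2 = σhi ^ 2 * Δt / h ^ 2 := by ring
      _ ≤ 1 := by linarith
  have hslope := sub_div_le_div_sig2_sub hσlo hσ (hle i)
  rw [div_eq_mul_one_div] at hslope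
  have hcenter := mul_le_mul_of_nonneg_left hr' (sub_nonneg.mpr (hle i))
  have hright := mul_le_mul_of_nonneg_left (hle (i + 1)) hr
  have hleft := mul_le_mul_of_nonneg_left (hle (i - 1)) hr
  linarith
end

section
/- (ℓ∞-stability of the w-scheme.) Suppose σ̄²·Δt/h² ≤ 1/2 and let W : ℤ → ℝ be bounded. Then sup_i |T(W)_i| ≤ sup_i |W_i|. Consequently, if W^n : ℤ → ℝ, n = 0,…,N, are bounded maps with W^n = T(W^{n+1}) for all 0 ≤ n < N, then sup_{0 ≤ n ≤ N} sup_i |W_i^n| ≤ sup_i |W_i^N|. -/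
/-- The one-step map preserves every uniform bound under the CFL condition. -/
lemma abs_Tmap_le {σlo σhi h Δt : ℝ} (hσlo : 0 < σlo) (hσ : σlo ≤ σhi)
    (hdt : 0 < Δt) (hcfl : σhi ^ 2 * Δt / h ^ 2 ≤ 1 / 2)
    {W : ℤ → ℝ} {M : ℝ} (hM : ∀ i, |W i| ≤ M) (i : ℤ) :
    |Tmap σlo σhi h Δt W i| ≤ M := by
  have hlo : 0 < σlo ^ 2 := by positivity
  have hsq : σlo ^ 2 ≤ σhi ^ 2 := by gcongr
  have hhi : 0 < σhi ^ 2 := hlo.trans_le hsq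
  obtain ⟨μ, hμ⟩ : ∃ μ, μ = Δt / h ^ 2 := ⟨_, rfl⟩
  have hμ0 : 0 ≤ μ := by rw [hμ]; positivity
  have hcfl' : σhi ^ 2 * μ ≤ 1 / 2 := by rwa [hμ, ← mul_div_assoc]
  have hlo' : σlo ^ 2 * μ ≤ 1 / 2 := (mul_le_mul_of_nonneg_right hsq hμ0).trans hcfl'
  have hB (s : ℝ) : W i + Δt * s / 2 * ((W (i + 1) - 2 * W i + W (i - 1)) / h ^ 2) =
      (1 - s * μ) * W i + s * μ * ((W (i + 1) + W (i - 1)) / 2) := by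
    rw [hμ]; ring
  obtain ⟨hl, hr⟩ := abs_le.mp (hM i)
  obtain ⟨hl₁, hr₁⟩ := abs_le.mp (hM (i + 1))
  obtain ⟨hl₂, hr₂⟩ := abs_le.mp (hM (i - 1))
  have hM0 : 0 ≤ M := (abs_nonneg _).trans (hM i)
  obtain ⟨a, ha⟩ : ∃ a, a = (W (i + 1) + W (i - 1)) / 2 := ⟨_, rfl⟩
  have hal : -M ≤ a := by linarith
  have har : a ≤ M := by linarith
  have hconv (t : ℝ) (ht : 0 ≤ t) (ht' : t ≤ 1 / 2) : |(1 - t) * W i + t * a| ≤ M := by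
    rw [abs_le]
    constructor <;> nlinarith
  unfold Tmap Fflux Bmap
  rw [hB, ← ha]
  by_cases hW : 0 ≤ W i
  · have hs : sig2 σlo σhi (W i) = σhi ^ 2 := if_pos hW
    rw [hs]
    have hb := hconv _ (mul_nonneg hhi.le hμ0) hcfl'
    generalize (1 - σhi ^ 2 * μ) * W i + σhi ^ 2 * μ * a = b at hb ⊢
    have hsb : 0 ≤ sig2 σlo σhi b ∧ sig2 σlo σhi b ≤ σhi ^ 2 := by
      unfold sig2; split_ifs
      · exact ⟨hhi.le, le_rfl⟩
      · exact ⟨hlo.le, hsq⟩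
    rw [abs_div, abs_mul, abs_of_nonneg hsb.1, abs_of_pos hhi, div_le_iff₀ hhi, mul_comm]
    exact mul_le_mul hb hsb.2 hsb.1 hM0
  · have hs : sig2 σlo σhi (W i) = σlo ^ 2 := if_neg hW
    rw [hs]
    have hb := hconv _ (mul_nonneg hlo.le hμ0) hlo'
    have hup : (1 - σlo ^ 2 * μ) * W i + σlo ^ 2 * μ * a ≤ σlo ^ 2 * μ * M := by
      have h₁ : (1 - σlo ^ 2 * μ) * W i ≤ 0 :=
        mul_nonpos_of_nonneg_of_nonpos (by linarith) (not_le.mp hW).le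
      have h₂ := mul_le_mul_of_nonneg_left har (mul_nonneg hlo.le hμ0)
      linarith
    generalize (1 - σlo ^ 2 * μ) * W i + σlo ^ 2 * μ * a = b at hb hup ⊢
    by_cases hb0 : 0 ≤ b
    · have hsb : sig2 σlo σhi b = σhi ^ 2 := if_pos hb0
      rw [hsb, abs_of_nonneg (by positivity), div_le_iff₀ hlo]
      calc σhi ^ 2 * b ≤ σhi ^ 2 * (σlo ^ 2 * μ * M) := by gcongr
        _ = σhi ^ 2 * μ * (M * σlo ^ 2) := by ring
        _ ≤ 1 * (M * σlo ^ 2) := by gcongr; linarith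
        _ = M * σlo ^ 2 := one_mul _
    · have hsb : sig2 σlo σhi b = σlo ^ 2 := if_neg hb0
      rwa [hsb, mul_div_cancel_left₀ _ hlo.ne']

/-- ℓ∞-stability of the `w`-scheme: if `σ̄²·Δt/h² ≤ 1/2` then
`sup_i |T(W)_i| ≤ sup_i |W_i|` for bounded `W`; consequently a backward cascade
`W^n = T(W^{n+1})` is bounded by the terminal level. -/
theorem stmt15 (σlo σhi h Δt : ℝ) (hσlo : 0 < σlo) (hσ : σlo ≤ σhi)
    (hh : 0 < h) (hdt : 0 < Δt) (hcfl : σhi ^ 2 * Δt / h ^ 2 ≤ 1 / 2) :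
    (∀ W : ℤ → ℝ, BddAbove (Set.range fun i => |W i|) →
      (⨆ i : ℤ, |Tmap σlo σhi h Δt W i|) ≤ ⨆ i : ℤ, |W i|) ∧
    (∀ (N : ℕ) (W : ℕ → ℤ → ℝ),
      (∀ n, BddAbove (Set.range fun i => |W n i|)) →
      (∀ n < N, ∀ i : ℤ, W n i = Tmap σlo σhi h Δt (W (n + 1)) i) →
      ∀ n ≤ N, (⨆ i : ℤ, |W n i|) ≤ ⨆ i : ℤ, |W N i|) := by
  have step (W : ℤ → ℝ) (hW : BddAbove (Set.range fun i => |W i|)) :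
      (⨆ i : ℤ, |Tmap σlo σhi h Δt W i|) ≤ ⨆ i : ℤ, |W i| :=
    ciSup_le fun i => abs_Tmap_le hσlo hσ hdt hcfl (fun j => le_ciSup hW j) i
  refine ⟨step, fun N W hW hT n hn => ?_⟩
  induction hn using Nat.decreasingInduction with
  | self => exact le_rfl
  | of_succ k hk ih =>
    refine le_trans ?_ ih
    simp only [hT k hk]
    exact step _ (hW (k + 1))
end
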